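/- arXiv:2012.13124 — 7 statements merged into one kernel-verified Lean document; each statement's English description precedes it below -/
import Mathlib

section
/- Let n ∈ ℕ with n ≥ 2, let E be a vector lattice, and let V be a real vector space. Suppose P : E → V is an n-homogeneous polynomial, i.e., P(f) = Ṗ(f,…,f) for a symmetric n-linear map Ṗ : Eⁿ → V. Then P is orthogonally additive if and only if P is positively orthogonally additive. -/
/-- In a lattice-ordered group, disjointness from a positive element is additive. -/
theorem inf_add_eq_zero_of_inf_eq_zero {E : Type*} [Lattice E] [AddCommGroup E] [AddLeftMono E]
    {x y z : E} (hx : 0 ≤ x) (hy : 0 ≤ y) (hz : 0 ≤ z) (hxy : x ⊓ y = 0) (hxz : x ⊓ z = 0) :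
    x ⊓ (y + z) = 0 := by
  have hle : x ⊓ (y + z) ≤ z := by
    calc x ⊓ (y + z) ≤ (x + z) ⊓ (y + z) := inf_le_inf_right _ (le_add_of_nonneg_right hz)
      _ = z := by rw [← inf_add, hxy, zero_add]
  exact le_antisymm ((le_inf inf_le_left hle).trans hxz.le) (le_inf hx (add_nonneg hy hz))

/-- In a lattice-ordered group, disjointness of positive elements is stable under natural
multiples. -/
theorem inf_nsmul_eq_zero_of_inf_eq_zero {E : Type*} [Lattice E] [AddCommGroup E] [AddLeftMono E]
    {x y : E} (hx : 0 ≤ x) (hy : 0 ≤ y) (hxy : x ⊓ y = 0) (m : ℕ) : x ⊓ m • y = 0 := by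
  induction m with
  | zero => simpa using hx
  | succ m ih =>
    rw [succ_nsmul]
    exact inf_add_eq_zero_of_inf_eq_zero hx (nsmul_nonneg hy m) hy ih hxy

/-- A diagonal multilinear identity `P (x + t y) = P x + tⁿ P y` valid for natural `t` holds for
all real `t`. -/
theorem MultilinearMap.diag_add_smul_of_nat {E V : Type*} [AddCommGroup E] [Module ℝ E]
    [AddCommGroup V] [Module ℝ V] {n : ℕ} (P' : MultilinearMap ℝ (fun _ : Fin n => E) V)
    (x y : E)
    (h : ∀ m : ℕ, P' (fun _ => x + (m : ℝ) • y) = P' (fun _ => x) + (m : ℝ) ^ n • P' (fun _ => y))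
    (t : ℝ) : P' (fun _ => x + t • y) = P' (fun _ => x) + t ^ n • P' (fun _ => y) := by
  classical
  rw [← sub_eq_zero, ← Module.forall_dual_apply_eq_zero_iff ℝ]
  intro φ
  let p : Polynomial ℝ :=
    ∑ s : Finset (Fin n),
      Polynomial.C (φ (P' (s.piecewise (fun _ => y) (fun _ => x)))) * Polynomial.X ^ s.card
    - Polynomial.C (φ (P' (fun _ => x))) - Polynomial.C (φ (P' (fun _ => y))) * Polynomial.X ^ n
  have hp (r : ℝ) : p.eval r =
      φ (P' (fun _ => x + r • y) - (P' (fun _ => x) + r ^ n • P' (fun _ => y))) := by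
    have key : P' (fun _ => x + r • y) =
        ∑ s : Finset (Fin n), r ^ s.card • P' (s.piecewise (fun _ => y) (fun _ => x)) := by
      have hadd : (fun _ : Fin n => x + r • y) = (fun _ => r • y) + fun _ => x := by
        ext; simp [add_comm]
      rw [hadd, P'.map_add_univ]
      refine Finset.sum_congr rfl fun s _ => ?_
      have := P'.map_piecewise_smul (fun _ => r) (s.piecewise (fun _ => y) (fun _ => x)) s
      rw [Finset.prod_const] at this
      rw [← this]
      congr 1
      ext i
      by_cases hi : i ∈ s <;> simp [hi]
    rw [key, map_sub, map_add, _root_.map_sum]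
    simp only [p, Polynomial.eval_sub, Polynomial.eval_finsetSum, Polynomial.eval_mul,
      Polynomial.eval_C, Polynomial.eval_pow, Polynomial.eval_X, map_smul, smul_eq_mul, mul_comm,
      sub_sub, Polynomial.eval_add]
  have hzero : p = 0 := by
    refine Polynomial.eq_zero_of_infinite_isRoot p
      ((Set.infinite_range_of_injective (Nat.cast_injective (R := ℝ))).mono ?_)
    rintro _ ⟨m, rfl⟩
    simp [Polynomial.IsRoot, hp, h m]
  rw [← hp, hzero, Polynomial.eval_zero]

/-- For an `n`-homogeneous polynomial `P` (given by a symmetric `n`-linear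
map `P'`) on a vector lattice `E` with values in a real vector space `V`, with `n ≥ 2`,
`P` is orthogonally additive iff it is positively orthogonally additive. -/
theorem orthAdd_iff_posOrthAdd
    {E V : Type*} [Lattice E] [AddCommGroup E]
    [CovariantClass E E (· + ·) (· ≤ ·)] [Module ℝ E] [PosSMulMono ℝ E]
    [AddCommGroup V] [Module ℝ V]
    (n : ℕ) (hn : 2 ≤ n) (P : E → V)
    (P' : MultilinearMap ℝ (fun _ : Fin n => E) V)
    (hsymm : ∀ (σ : Equiv.Perm (Fin n)) (v : Fin n → E), P' (v ∘ σ) = P' v)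
    (hP : ∀ f : E, P f = P' (fun _ => f)) :
    (∀ f g : E, |f| ⊓ |g| = 0 → P (f + g) = P f + P g) ↔
      (∀ f g : E, 0 ≤ f → 0 ≤ g → |f| ⊓ |g| = 0 → P (f + g) = P f + P g) := by
  have : AddLeftMono E := ‹CovariantClass E E (· + ·) (· ≤ ·)›
  refine ⟨fun h f g _ _ => h f g, fun h f g hfg => ?_⟩
  have hpos {x y : E} (hx : 0 ≤ x) (hy : 0 ≤ y) (hxy : x ⊓ y = 0) : P (x + y) = P x + P y :=
    h x y hx hy (by rwa [abs_of_nonneg hx, abs_of_nonneg hy])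
  have hsmul (t : ℝ) (y : E) : P (t • y) = t ^ n • P y := by
    simpa [hP] using P'.map_smul_univ (fun _ => t) (fun _ => y)
  have hsub {x y : E} (hx : 0 ≤ x) (hy : 0 ≤ y) (hxy : x ⊓ y = 0) :
      P (x - y) = P x + (-1 : ℝ) ^ n • P y := by
    have := P'.diag_add_smul_of_nat x y (fun m => by
      rw [← hP, ← hP, ← hP, ← hsmul, Nat.cast_smul_eq_nsmul]
      exact hpos hx (nsmul_nonneg hy m) (inf_nsmul_eq_zero_of_inf_eq_zero hx hy hxy m)) (-1)
    simpa [hP, sub_eq_add_neg] using this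
  have hdisj {a b : E} (ha : 0 ≤ a) (hb : 0 ≤ b) (haf : a ≤ |f|) (hbg : b ≤ |g|) : a ⊓ b = 0 :=
    le_antisymm ((inf_le_inf haf hbg).trans hfg.le) (le_inf ha hb)
  have hf := posPart_nonneg f
  have hf' := negPart_nonneg f
  have hg := posPart_nonneg g
  have hg' := negPart_nonneg g
  have hfa : f⁺ ≤ |f| := sup_le (le_abs_self f) (abs_nonneg f)
  have hfa' : f⁻ ≤ |f| := sup_le (neg_le_abs f) (abs_nonneg f)
  have hga : g⁺ ≤ |g| := sup_le (le_abs_self g) (abs_nonneg g)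
  have hga' : g⁻ ≤ |g| := sup_le (neg_le_abs g) (abs_nonneg g)
  have hff : f⁺ ⊓ f⁻ = 0 := posPart_inf_negPart_eq_zero f
  have hgg : g⁺ ⊓ g⁻ = 0 := posPart_inf_negPart_eq_zero g
  have hcross : (f⁺ + g⁺) ⊓ (f⁻ + g⁻) = 0 := by
    refine inf_add_eq_zero_of_inf_eq_zero (add_nonneg hf hg) hf' hg' ?_ ?_ <;> rw [inf_comm]
    · exact inf_add_eq_zero_of_inf_eq_zero hf' hf hg (by rwa [inf_comm]) (hdisj hf' hg hfa' hga)
    · exact inf_add_eq_zero_of_inf_eq_zero hg' hf hg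
        (by rw [inf_comm]; exact hdisj hf hg' hfa hga') (by rwa [inf_comm])
  have hPf : P f = P f⁺ + (-1 : ℝ) ^ n • P f⁻ := by
    rw [← hsub hf hf' hff, posPart_sub_negPart]
  have hPg : P g = P g⁺ + (-1 : ℝ) ^ n • P g⁻ := by
    rw [← hsub hg hg' hgg, posPart_sub_negPart]
  have hsum : f + g = (f⁺ + g⁺) - (f⁻ + g⁻) := by
    rw [add_sub_add_comm, posPart_sub_negPart, posPart_sub_negPart]
  rw [hsum, hsub (add_nonneg hf hg) (add_nonneg hf' hg') hcross,
    hpos hf hg (hdisj hf hg hfa hga), hpos hf' hg' (hdisj hf' hg' hfa' hga'), hPf, hPg, smul_add]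
  exact add_add_add_comm _ _ _ _
end

section
/- Let n ∈ ℕ with n ≥ 2, let E be a vector lattice, let V be a real vector space, and let P : E → V be an n-homogeneous polynomial with symmetric n-linear map Ṗ. If P is positively orthogonally additive, then for all disjoint f, g ∈ E⁺ and every k ∈ {1, …, n−1}, one has Ṗ(f^{n−k} g^{k}) = 0, where Ṗ(f^{n−k} g^{k}) denotes Ṗ evaluated at n−k copies of f and k copies of g. -/
/-- In a vector lattice, disjointness of positive elements is preserved by nonnegative scaling. -/
theorem inf_smul_eq_zero_of_inf_eq_zero {E : Type*} [Lattice E] [AddCommGroup E]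
    [CovariantClass E E (· + ·) (· ≤ ·)] [Module ℝ E] [PosSMulMono ℝ E]
    {f g : E} (hf : 0 ≤ f) (hg : 0 ≤ g) (h : f ⊓ g = 0) {t : ℝ} (ht : 0 ≤ t) :
    f ⊓ t • g = 0 := by
  have htg : 0 ≤ t • g := smul_nonneg ht hg
  refine le_antisymm ?_ (le_inf hf htg)
  have hc : 0 < 1 + t := by positivity
  have hfc : f ≤ (1 + t) • f := by
    rw [add_smul, one_smul]
    exact le_add_of_nonneg_right (smul_nonneg ht hf)
  have hgc : t • g ≤ (1 + t) • g := by
    rw [add_smul, one_smul]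
    exact le_add_of_nonneg_left hg
  have key : (1 + t)⁻¹ • (f ⊓ t • g) ≤ f ⊓ g := by
    refine le_inf ?_ ?_
    · have := smul_le_smul_of_nonneg_left (inf_le_left.trans hfc : f ⊓ t • g ≤ _)
        (inv_nonneg.2 hc.le)
      rwa [inv_smul_smul₀ hc.ne'] at this
    · have := smul_le_smul_of_nonneg_left (inf_le_right.trans hgc : f ⊓ t • g ≤ _)
        (inv_nonneg.2 hc.le)
      rwa [inv_smul_smul₀ hc.ne'] at this
  rw [h] at key
  have := smul_le_smul_of_nonneg_left key hc.le
  rwa [smul_inv_smul₀ hc.ne', smul_zero] at this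

/-- A symmetric function of `n` arguments, evaluated at copies of `g` on `s` and copies of `f` off
`s`, depends on `s` only through its cardinality. -/
theorem map_piecewise_eq_of_card_eq {ι E V : Type*} [Fintype ι] [DecidableEq ι]
    (F : (ι → E) → V) (hF : ∀ (σ : Equiv.Perm ι) (v : ι → E), F (v ∘ σ) = F v)
    (f g : E) {s t : Finset ι} (h : s.card = t.card) :
    F (s.piecewise (fun _ => g) (fun _ => f)) = F (t.piecewise (fun _ => g) (fun _ => f)) := by
  let e : {i // i ∈ s} ≃ {i // i ∈ t} := Finset.equivOfCardEq h
  rw [← hF e.extendSubtype (t.piecewise _ _)]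
  congr 1
  funext i
  by_cases hi : i ∈ s
  · simp [hi, e.extendSubtype_mem i hi]
  · simp [hi, e.extendSubtype_not_mem i hi]

/-- Expansion of a multilinear map along the diagonal at `f + t • g`, in powers of `t`. -/
theorem MultilinearMap.map_diag_add_smul {ι R E V : Type*} [Fintype ι] [DecidableEq ι]
    [CommSemiring R] [AddCommMonoid E] [Module R E] [AddCommMonoid V] [Module R V]
    (F : MultilinearMap R (fun _ : ι => E) V) (f g : E) (t : R) :
    F (fun _ => f + t • g) =
      ∑ s : Finset ι, t ^ s.card • F (s.piecewise (fun _ => g) (fun _ => f)) := by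
  have h := F.map_add_univ (fun _ => t • g) (fun _ => f)
  have h' : (fun _ : ι => f + t • g) = (fun _ => t • g) + (fun _ => f) := by
    funext i
    exact add_comm _ _
  rw [h', h]
  refine Finset.sum_congr rfl fun s _ => ?_
  rw [← Finset.prod_const, ← F.map_piecewise_smul]
  congr 1
  funext i
  by_cases hi : i ∈ s <;> simp [hi]

/-- If an `n`-homogeneous polynomial `P` (with symmetric `n`-linear map `P'`)
on a vector lattice is positively orthogonally additive, then for disjoint positive `f, g`
and `1 ≤ k ≤ n - 1`, `P'` vanishes on `n - k` copies of `f` and `k` copies of `g`. -/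
theorem posOrthAdd_mixed_terms_vanish
    {E V : Type*} [Lattice E] [AddCommGroup E]
    [CovariantClass E E (· + ·) (· ≤ ·)] [Module ℝ E] [PosSMulMono ℝ E]
    [AddCommGroup V] [Module ℝ V]
    (n : ℕ) (hn : 2 ≤ n) (P : E → V)
    (P' : MultilinearMap ℝ (fun _ : Fin n => E) V)
    (hsymm : ∀ (σ : Equiv.Perm (Fin n)) (v : Fin n → E), P' (v ∘ σ) = P' v)
    (hP : ∀ f : E, P f = P' (fun _ => f))
    (hpoa : ∀ f g : E, 0 ≤ f → 0 ≤ g → |f| ⊓ |g| = 0 → P (f + g) = P f + P g) :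
    ∀ f g : E, 0 ≤ f → 0 ≤ g → |f| ⊓ |g| = 0 →
      ∀ k : ℕ, 1 ≤ k → k ≤ n - 1 →
        P' (fun i : Fin n => if (i : ℕ) < n - k then f else g) = 0 := by
  classical
  intro f g hf hg hfg k hk1 hkn
  rw [abs_of_nonneg hf, abs_of_nonneg hg] at hfg
  set a : Finset (Fin n) → V := fun s => P' (s.piecewise (fun _ => g) (fun _ => f))
  let s₀ : Finset (Fin n) := Finset.univ.filter fun i => ¬ (i : ℕ) < n - k
  have hs₀ : s₀.card = k := by
    have h1 := Finset.card_filter_add_card_filter_not (s := (Finset.univ : Finset (Fin n)))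
      (fun i => (i : ℕ) < n - k)
    rw [Fin.card_filter_val_lt, Finset.card_univ, Fintype.card_fin] at h1
    change _ + s₀.card = n at h1
    omega
  have hgoal : (fun i : Fin n => if (i : ℕ) < n - k then f else g) =
      s₀.piecewise (fun _ => g) (fun _ => f) := by
    funext i
    by_cases hi : (i : ℕ) < n - k
    · rw [Finset.piecewise_eq_of_notMem _ _ _ (by simp only [s₀, Finset.mem_filter_univ, not_not, hi]), if_pos hi]
    · rw [Finset.piecewise_eq_of_mem _ _ _ (by simp only [s₀, Finset.mem_filter_univ, hi, not_false_iff]), if_neg hi]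
  rw [hgoal]
  have hexp : ∀ t : ℝ, 0 ≤ t → ∑ s, t ^ s.card • a s = P f + t ^ n • P g := by
    intro t ht
    have htg : 0 ≤ t • g := smul_nonneg ht hg
    have h := hpoa f (t • g) hf htg (by
      rw [abs_of_nonneg hf, abs_of_nonneg htg]
      exact inf_smul_eq_zero_of_inf_eq_zero hf hg hfg ht)
    rw [← P'.map_diag_add_smul, ← hP, h, hP (t • g), P'.map_smul_univ (fun _ => t) (fun _ => g),
      ← hP]
    simp
  rw [← Module.forall_dual_apply_eq_zero_iff ℝ]
  intro φ
  have hpoly : ∑ s, Polynomial.C (φ (a s)) * Polynomial.X ^ s.card =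
      Polynomial.C (φ (P f)) + Polynomial.C (φ (P g)) * Polynomial.X ^ n := by
    refine Polynomial.eq_of_infinite_eval_eq _ _ ((Set.Ici_infinite (0 : ℝ)).mono fun t ht => ?_)
    have h := congrArg φ (hexp t ht)
    simp only [map_sum, map_add, map_smul, smul_eq_mul] at h
    simp only [Set.mem_ofPred_eq, Polynomial.eval_finsetSum, Polynomial.eval_add,
      Polynomial.eval_mul, Polynomial.eval_C, Polynomial.eval_pow, Polynomial.eval_X]
    simpa only [mul_comm] using h
  have hcoeff := congrArg (fun p => Polynomial.coeff p k) hpoly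
  simp only [Polynomial.finsetSum_coeff, Polynomial.coeff_C_mul_X_pow, Polynomial.coeff_add,
    Polynomial.coeff_C, if_neg (show k ≠ 0 by omega), if_neg (show k ≠ n by omega),
    add_zero] at hcoeff
  have hsum : ∑ s : Finset (Fin n), (if k = s.card then φ (a s) else 0) =
      (Finset.univ.filter fun s : Finset (Fin n) => k = s.card).card • φ (a s₀) := by
    rw [← Finset.sum_filter, ← Finset.sum_const]
    refine Finset.sum_congr rfl fun s hs => ?_
    rw [Finset.mem_filter] at hs
    exact congrArg φ (map_piecewise_eq_of_card_eq P' hsymm f g (hs.2.symm.trans hs₀.symm))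
  rw [hsum, smul_eq_zero] at hcoeff
  refine hcoeff.resolve_left (Finset.card_ne_zero_of_mem (a := s₀) ?_)
  simp [hs₀]
end

section
/- Let n ∈ ℕ with n ≥ 2, let E be a vector lattice, let V be a real vector space, and let P : E → V be an n-homogeneous polynomial. If P is positively orthogonally additive, then P(f) = P(f⁺) + P(−f⁻) holds for every f ∈ E, where f⁺ = f ⊔ 0 and f⁻ = (−f) ⊔ 0. -/
theorem inf_nsmul_eq_zero {E : Type*} [Lattice E] [AddCommGroup E] [AddLeftMono E] {a b : E}
    (ha : 0 ≤ a) (hb : 0 ≤ b) (hab : a ⊓ b = 0) (k : ℕ) : a ⊓ k • b = 0 := by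
  induction k with
  | zero => simpa using ha
  | succ k ih =>
    have hkb : 0 ≤ k • b := nsmul_nonneg hb k
    refine le_antisymm ?_ (le_inf ha (nsmul_nonneg hb _))
    set y := a ⊓ (k + 1) • b
    have hya : y ≤ a := inf_le_left
    have hyb : y ≤ k • b + b := (inf_le_right).trans_eq (succ_nsmul b k)
    have hyk : y - k • b ≤ 0 :=
      hab ▸ le_inf ((sub_le_self y hkb).trans hya) (sub_le_iff_le_add'.2 hyb)
    exact ih ▸ le_inf hya (sub_nonpos.1 hyk)

open Polynomial in
/-- Along any line, a scalar-valued homogeneous polynomial map is given by a polynomial. -/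
theorem MultilinearMap.exists_polynomial_eval_eq {E : Type*} [AddCommGroup E] [Module ℝ E] {n : ℕ}
    (A : MultilinearMap ℝ (fun _ : Fin n => E) ℝ) (a b : E) :
    ∃ p : ℝ[X], ∀ t : ℝ, p.eval t = A (fun _ => a + t • b) := by
  classical
  refine ⟨∑ s : Finset (Fin n), C (A (s.piecewise (fun _ => b) fun _ => a)) * X ^ s.card,
    fun t => ?_⟩
  have hadd := A.map_add_univ (fun _ => t • b) (fun _ => a)
  rw [show (fun _ : Fin n => a + t • b) = (fun _ => t • b) + fun _ => a from
    funext fun _ => add_comm _ _, hadd, eval_finsetSum]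
  refine Finset.sum_congr rfl fun s _ => ?_
  have hpw : s.piecewise (fun _ => t • b) (fun _ => a) =
      s.piecewise (fun i => (fun _ => t) i • s.piecewise (fun _ => b) (fun _ => a) i)
        (s.piecewise (fun _ => b) fun _ => a) := by
    ext i
    by_cases hi : i ∈ s <;> simp [hi]
  rw [hpw, A.map_piecewise_smul, Finset.prod_const, eval_C_mul, eval_X_pow, smul_eq_mul, mul_comm]

open Polynomial in
/-- If a homogeneous polynomial map is additive on `a` and every natural multiple of `b`, then it
is additive on `a` and `-b`. -/
theorem MultilinearMap.map_sub_diag_of_map_add_nsmul {E V : Type*} [AddCommGroup E] [Module ℝ E]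
    [AddCommGroup V] [Module ℝ V] {n : ℕ} (A : MultilinearMap ℝ (fun _ : Fin n => E) V) (a b : E)
    (h : ∀ k : ℕ, A (fun _ => a + k • b) = A (fun _ => a) + A (fun _ => k • b)) :
    A (fun _ => a - b) = A (fun _ => a) + A (fun _ => -b) := by
  rw [← sub_eq_zero, ← Module.forall_dual_apply_eq_zero_iff ℝ]
  intro φ
  obtain ⟨p, hp⟩ := (φ.compMultilinearMap A).exists_polynomial_eval_eq a b
  obtain ⟨q, hq⟩ := (φ.compMultilinearMap A).exists_polynomial_eval_eq 0 b
  have hpq : p = C (φ (A fun _ => a)) + q := by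
    refine eq_of_infinite_eval_eq _ _
      ((Set.infinite_range_of_injective (Nat.cast_injective (R := ℝ))).mono ?_)
    rintro _ ⟨k, rfl⟩
    simp [hp, hq, Nat.cast_smul_eq_nsmul, h]
  have heval := congrArg (eval (-1)) hpq
  simp only [eval_add, eval_C, hp, hq, LinearMap.compMultilinearMap_apply, neg_smul, one_smul,
    ← sub_eq_add_neg, zero_sub] at heval
  rw [map_sub, map_add, heval, sub_self]


/-- If an `n`-homogeneous polynomial `P` on a vector lattice is positively
orthogonally additive, then `P f = P f⁺ + P (-f⁻)` for every `f`, where `f⁺ = f ⊔ 0` and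
`f⁻ = (-f) ⊔ 0`. -/
theorem posOrthAdd_decomposition
    {E V : Type*} [Lattice E] [AddCommGroup E]
    [CovariantClass E E (· + ·) (· ≤ ·)] [Module ℝ E] [PosSMulMono ℝ E]
    [AddCommGroup V] [Module ℝ V]
    (n : ℕ) (hn : 2 ≤ n) (P : E → V)
    (P' : MultilinearMap ℝ (fun _ : Fin n => E) V)
    (hsymm : ∀ (σ : Equiv.Perm (Fin n)) (v : Fin n → E), P' (v ∘ σ) = P' v)
    (hP : ∀ f : E, P f = P' (fun _ => f))
    (hpoa : ∀ f g : E, 0 ≤ f → 0 ≤ g → |f| ⊓ |g| = 0 → P (f + g) = P f + P g) :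
    ∀ f : E, P f = P (f ⊔ 0) + P (-((-f) ⊔ 0)) := by
  intro f
  have ha : 0 ≤ f ⊔ 0 := le_sup_right
  have hb : 0 ≤ -f ⊔ 0 := le_sup_right
  have hab : (f ⊔ 0) ⊓ (-f ⊔ 0) = 0 := posPart_inf_negPart_eq_zero f
  have hf : f = (f ⊔ 0) - (-f ⊔ 0) := (posPart_sub_negPart f).symm
  have hsub := P'.map_sub_diag_of_map_add_nsmul (f ⊔ 0) (-f ⊔ 0) fun k => by
    have hkb : 0 ≤ k • (-f ⊔ 0) := nsmul_nonneg hb k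
    simpa only [hP] using hpoa (f ⊔ 0) (k • (-f ⊔ 0)) ha hkb
      (by rw [abs_of_nonneg ha, abs_of_nonneg hkb, inf_nsmul_eq_zero ha hb hab])
  rw [← hf] at hsub
  simpa only [hP] using hsub
end

section
/- Let E be a vector lattice, let m be a real number with m > 1, and let f, g ∈ E⁺ be disjoint. Then f + g is the least upper bound (supremum) in E of the set { a₁ • f + a₂ • g : a₁, a₂ ∈ [0,1] ⊆ ℝ, a₁^m + a₂^m = 1 } (real powers). In particular, taking m = n/(n−1) to be the Hölder conjugate of an integer n ≥ 2, this identifies f + g with the n-th root mean power 𝔖ₙ(f, g, 0, …, 0). -/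
/-- For disjoint positive elements `f, g` of a vector lattice `E` and a real
number `m > 1`, the element `f + g` is the least upper bound of the set
`{a₁ • f + a₂ • g : a₁, a₂ ∈ [0,1], a₁ ^ m + a₂ ^ m = 1}` (real powers). -/
theorem add_isLUB_rootMeanPower_set
    {E : Type*} [Lattice E] [AddCommGroup E]
    [CovariantClass E E (· + ·) (· ≤ ·)] [Module ℝ E] [PosSMulMono ℝ E]
    (m : ℝ) (hm : 1 < m) (f g : E) (hf : 0 ≤ f) (hg : 0 ≤ g)
    (hdisj : |f| ⊓ |g| = 0) :
    IsLUB {x : E | ∃ a₁ a₂ : ℝ, a₁ ∈ Set.Icc (0 : ℝ) 1 ∧ a₂ ∈ Set.Icc (0 : ℝ) 1 ∧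
      a₁ ^ m + a₂ ^ m = 1 ∧ x = a₁ • f + a₂ • g} (f + g) := by
  have hsup : f ⊔ g = f + g := by
    rw [abs_of_nonneg hf, abs_of_nonneg hg] at hdisj
    rw [← inf_add_sup f g, hdisj, zero_add]
  have smul_le : ∀ (a : ℝ) (h : E), a ≤ 1 → 0 ≤ h → a • h ≤ h := fun a h ha hh => by
    have := smul_nonneg (sub_nonneg.2 ha) hh
    rwa [sub_smul, one_smul, sub_nonneg] at this
  have zero_pow : (0 : ℝ) ^ m = 0 := Real.zero_rpow (by linarith)
  constructor
  · rintro x ⟨a₁, a₂, h₁, h₂, -, rfl⟩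
    exact add_le_add (smul_le a₁ f h₁.2 hf) (smul_le a₂ g h₂.2 hg)
  · intro v hv
    rw [← hsup]
    exact sup_le (hv ⟨1, 0, by simp, by simp, by simp [zero_pow], by simp⟩)
      (hv ⟨0, 1, by simp, by simp, by simp [zero_pow], by simp⟩)
end

section
/- Let n ∈ ℕ with n ≥ 2, let k ∈ {1, …, n−1}, let E be an Archimedean vector lattice, and let f, g ∈ E⁺ be disjoint. Then 0 is the greatest lower bound (infimum) in E of the set { (θ₁ + ⋯ + θ_{n−k}) • f + (θ_{n−k+1} + ⋯ + θ_n) • g : θ₁, …, θ_n ∈ ℝ, each θᵢ > 0, and θ₁ · θ₂ ⋯ θ_n = 1 }. (Equivalently, the n-th geometric mean 𝔊ₙ(f^{n−k} g^{k}) of n−k copies of f and k copies of g equals 0.) -/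
open Finset in
/-- A positive family with product one can have arbitrarily small sum over a proper subset. -/
theorem exists_pos_prod_eq_one_sum_filter_le {ι : Type*} [Fintype ι] (p : ι → Prop)
    [DecidablePred p] (hp : ∃ i, ¬ p i) {ε : ℝ} (hε : 0 < ε) :
    ∃ θ : ι → ℝ, (∀ i, 0 < θ i) ∧ ∏ i, θ i = 1 ∧ ∑ i ∈ univ.filter p, θ i ≤ ε := by
  obtain ⟨j, hj⟩ := hp
  set a := #(univ.filter p) with ha
  set b := #(univ.filter fun i => ¬ p i) with hb
  have hb0 : b ≠ 0 := (card_pos.2 ⟨j, by simpa using hj⟩).ne'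
  have hm1 : 1 ≤ 1 + a / ε := le_add_of_nonneg_right (by positivity)
  have ham : a ≤ ε * (1 + a / ε) := by
    rw [mul_add, mul_div_cancel₀ _ hε.ne']
    linarith
  generalize 1 + a / ε = m at hm1 ham
  have hm0 : 0 < m := by linarith
  refine ⟨fun i => if p i then (m ^ b)⁻¹ else m ^ a, fun i => ?_, ?_, ?_⟩
  · dsimp only
    split_ifs <;> positivity
  · rw [prod_ite, prod_const, prod_const, ← ha, ← hb, inv_pow, ← pow_mul, ← pow_mul,
      mul_comm b a, inv_mul_cancel₀ (by positivity)]
  · rw [sum_congr rfl fun i hi => if_pos (mem_filter.1 hi).2, sum_const, ← ha, nsmul_eq_mul,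
      ← div_eq_mul_inv, div_le_iff₀ (by positivity)]
    exact ham.trans (mul_le_mul_of_nonneg_left (le_self_pow₀ hm1 hb0) hε.le)

section VectorLattice

variable {E : Type*} [Lattice E] [AddCommGroup E] [AddLeftMono E] [Module ℝ E] [PosSMulMono ℝ E]

theorem smul_le_smul_of_le_of_nonneg_right {a b : ℝ} (hab : a ≤ b) {x : E} (hx : 0 ≤ x) :
    a • x ≤ b • x := by
  rw [← sub_nonneg, ← sub_smul]
  exact smul_nonneg (sub_nonneg.2 hab) hx

theorem le_zero_of_le_smul_of_le_smul {f g x : E} (hf : 0 ≤ f) (hg : 0 ≤ g) (hfg : f ⊓ g = 0)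
    {a b : ℝ} (hxa : x ≤ a • f) (hxb : x ≤ b • g) : x ≤ 0 := by
  set c : ℝ := max 1 (max a b)
  have hc : 0 < c := lt_of_lt_of_le one_pos (le_max_left _ _)
  have key : ∀ {d : ℝ} {y : E}, 0 ≤ y → d ≤ c → x ≤ d • y → c⁻¹ • x ≤ y := by
    intro d y hy hd h
    have := smul_le_smul_of_nonneg_left
      (h.trans (smul_le_smul_of_le_of_nonneg_right hd hy)) (inv_pos.2 hc).le
    rwa [inv_smul_smul₀ hc.ne'] at this
  have h : c⁻¹ • x ≤ 0 := hfg ▸ le_inf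
    (key hf ((le_max_left a b).trans (le_max_right _ _)) hxa)
    (key hg ((le_max_right a b).trans (le_max_right _ _)) hxb)
  simpa [smul_inv_smul₀ hc.ne'] using smul_le_smul_of_nonneg_left h hc.le

theorem le_smul_add_of_le_of_le {f g v : E} (hf : 0 ≤ f) (hg : 0 ≤ g) (hfg : f ⊓ g = 0)
    {a b c d ε : ℝ} (hb : b ≤ ε) (hc : c ≤ ε)
    (h₁ : v ≤ a • f + b • g) (h₂ : v ≤ c • f + d • g) : v ≤ ε • (f + g) := by
  have hεf : c • f ≤ ε • f := smul_le_smul_of_le_of_nonneg_right hc hf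
  have hεg : b • g ≤ ε • g := smul_le_smul_of_le_of_nonneg_right hb hg
  rw [← sub_nonpos]
  refine le_zero_of_le_smul_of_le_smul (a := a - ε) (b := d - ε) hf hg hfg ?_ ?_
  · rw [sub_le_iff_le_add]
    convert h₁.trans (add_le_add_right hεg _) using 1
    module
  · rw [sub_le_iff_le_add]
    convert h₂.trans (add_le_add_left hεf _) using 1
    module

end VectorLattice


/-- In an Archimedean vector lattice, for disjoint positive `f, g`, `n ≥ 2`
and `1 ≤ k ≤ n - 1`, `0` is the greatest lower bound of the set
`{(θ₁ + ⋯ + θ_{n-k}) • f + (θ_{n-k+1} + ⋯ + θ_n) • g : θᵢ > 0, ∏ θᵢ = 1}`;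
i.e. the geometric mean `𝔊ₙ(f^{n-k} g^k)` vanishes. -/
theorem geometricMean_of_disjoint_isGLB_zero
    {E : Type*} [Lattice E] [AddCommGroup E]
    [CovariantClass E E (· + ·) (· ≤ ·)] [Module ℝ E] [PosSMulMono ℝ E]
    (hArch : ∀ x y : E, (∀ n : ℕ, n • x ≤ y) → x ≤ 0)
    (n k : ℕ) (hn : 2 ≤ n) (hk1 : 1 ≤ k) (hk2 : k ≤ n - 1)
    (f g : E) (hf : 0 ≤ f) (hg : 0 ≤ g) (hdisj : |f| ⊓ |g| = 0) :
    IsGLB {x : E | ∃ θ : Fin n → ℝ, (∀ i, 0 < θ i) ∧ (∏ i, θ i) = 1 ∧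
      x = (∑ i ∈ Finset.univ.filter (fun i : Fin n => (i : ℕ) < n - k), θ i) • f +
          (∑ i ∈ Finset.univ.filter (fun i : Fin n => n - k ≤ (i : ℕ)), θ i) • g} 0 := by
  have hfg : f ⊓ g = 0 := by rwa [abs_of_nonneg hf, abs_of_nonneg hg] at hdisj
  refine ⟨?_, fun v hv => hArch v (f + g) fun N => ?_⟩
  · rintro x ⟨θ, hθ, -, rfl⟩
    exact add_nonneg (smul_nonneg (Finset.sum_nonneg fun i _ => (hθ i).le) hf)
      (smul_nonneg (Finset.sum_nonneg fun i _ => (hθ i).le) hg)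
  rcases N.eq_zero_or_pos with rfl | hN
  · simpa using add_nonneg hf hg
  have hN' : (0 : ℝ) < N := Nat.cast_pos.2 hN
  obtain ⟨θ, hθ, hθ1, hθs⟩ := exists_pos_prod_eq_one_sum_filter_le
    (fun i : Fin n => n - k ≤ (i : ℕ)) ⟨⟨0, by omega⟩, by simp; omega⟩ (inv_pos.2 hN')
  obtain ⟨η, hη, hη1, hηs⟩ := exists_pos_prod_eq_one_sum_filter_le
    (fun i : Fin n => (i : ℕ) < n - k) ⟨⟨n - 1, by omega⟩, by simp; omega⟩ (inv_pos.2 hN')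
  have h := smul_le_smul_of_nonneg_left (le_smul_add_of_le_of_le hf hg hfg hθs hηs
    (hv ⟨θ, hθ, hθ1, rfl⟩) (hv ⟨η, hη, hη1, rfl⟩)) hN'.le
  rwa [smul_inv_smul₀ hN'.ne', Nat.cast_smul_eq_nsmul] at h
end

section
/- Let n, r ∈ ℕ with n ≥ 2 and r ≥ 2, let m = n/(n−1) be the Hölder conjugate of n, let E be an Archimedean vector lattice, let V be a real vector space, and let P : E → V be an n-homogeneous polynomial. Suppose that for all f₁, …, f_r ∈ E⁺ and every s ∈ E such that s is the least upper bound of the set { ∑_{k=1}^{r} a_k • f_k : a₁, …, a_r ∈ [0,1] ⊆ ℝ, ∑_{k=1}^{r} a_k^m = 1 } (real powers), one has P(s) = ∑_{k=1}^{r} P(f_k). Then P is orthogonally additive. (This is Theorem 2.2(i): attainment of Kusraeva's root-mean-power identity P(𝔖ₙ(f₁,…,f_r)) = ∑ P(f_k) on the positive cone forces orthogonal additivity, using the explicit supremum formula for 𝔖ₙ.) -/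
/-- Restricted to a line `s ↦ x + s • y`, a homogeneous polynomial becomes, after applying a linear
functional, a real polynomial in `s`. -/
theorem MultilinearMap.exists_polynomial_eval_line {E V : Type*} [AddCommGroup E] [Module ℝ E]
    [AddCommGroup V] [Module ℝ V] {n : ℕ} (P' : MultilinearMap ℝ (fun _ : Fin n => E) V)
    (φ : V →ₗ[ℝ] ℝ) (x y : E) :
    ∃ p : Polynomial ℝ, ∀ s : ℝ, p.eval s = φ (P' fun _ => x + s • y) := by
  refine ⟨∑ S : Finset (Fin n), Polynomial.C (φ (P' (S.piecewise (fun _ => x) (fun _ => y)))) *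
    ∏ i, (if i ∈ S then 1 else Polynomial.X), fun s => ?_⟩
  have h := P'.map_add_univ (fun _ => x) (fun _ => s • y)
  have h' : (fun _ : Fin n => x + s • y) = (fun _ => x) + fun _ => s • y := rfl
  rw [h', h, _root_.map_sum, Polynomial.eval_finsetSum]
  refine Finset.sum_congr rfl fun S _ => ?_
  have hS : S.piecewise (fun _ => x) (fun _ => s • y) = fun i =>
      (if i ∈ S then (1 : ℝ) else s) • S.piecewise (fun _ => x) (fun _ => y) i := by
    funext i
    by_cases hi : i ∈ S <;> simp [hi]
  rw [hS, P'.map_smul_univ, map_smul, smul_eq_mul, Polynomial.eval_mul, Polynomial.eval_C,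
    Polynomial.eval_prod, mul_comm]
  congr 1
  refine Finset.prod_congr rfl fun i _ => ?_
  split_ifs <;> simp

/-- If the values of a homogeneous polynomial are additive along two lines at every nonnegative
parameter, then they are additive at every parameter. -/
theorem MultilinearMap.line_additive_of_nonneg {E V : Type*} [AddCommGroup E] [Module ℝ E]
    [AddCommGroup V] [Module ℝ V] {n : ℕ} (P' : MultilinearMap ℝ (fun _ : Fin n => E) V)
    (x y z w : E)
    (h : ∀ s : ℝ, 0 ≤ s → P' (fun _ => (x + s • y) + (z + s • w)) =
      P' (fun _ => x + s • y) + P' (fun _ => z + s • w)) (s : ℝ) :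
    P' (fun _ => (x + s • y) + (z + s • w)) =
      P' (fun _ => x + s • y) + P' (fun _ => z + s • w) := by
  have hline (t : ℝ) : (x + t • y) + (z + t • w) = (x + z) + t • (y + w) := by
    rw [smul_add]; abel
  rw [← sub_eq_zero, ← Module.forall_dual_apply_eq_zero_iff ℝ]
  intro φ
  obtain ⟨p, hp⟩ := P'.exists_polynomial_eval_line φ (x + z) (y + w)
  obtain ⟨q, hq⟩ := P'.exists_polynomial_eval_line φ x y
  obtain ⟨q', hq'⟩ := P'.exists_polynomial_eval_line φ z w
  have hzero : p - (q + q') = 0 := by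
    refine Polynomial.eq_zero_of_infinite_isRoot _ ((Set.Ici_infinite (0 : ℝ)).mono fun t ht => ?_)
    have := h t ht
    simp only [hline] at this
    simp only [Set.mem_ofPred_eq, Polynomial.IsRoot, Polynomial.eval_sub, Polynomial.eval_add,
      hp, hq, hq', this, map_add, sub_self]
  have := congrArg (Polynomial.eval s) hzero
  simp only [Polynomial.eval_sub, Polynomial.eval_add, Polynomial.eval_zero, hp, hq, hq'] at this
  simpa only [hline, map_sub, map_add] using this

/-- Positive combinations of the parts of disjoint elements are disjoint. -/
theorem posPart_add_smul_negPart_inf_eq_zero {E : Type*} [Lattice E] [AddCommGroup E]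
    [IsOrderedAddMonoid E] [Module ℝ E] [PosSMulMono ℝ E] {f g : E} (hfg : |f| ⊓ |g| = 0)
    {s : ℝ} (hs : 0 ≤ s) : (f⁺ + s • f⁻) ⊓ (g⁺ + s • g⁻) = 0 := by
  have hnonneg (h : E) : 0 ≤ h⁺ + s • h⁻ :=
    add_nonneg (posPart_nonneg h) (smul_nonneg hs (negPart_nonneg h))
  have hc : 0 < 1 + s := by linarith
  have hle (h : E) : (1 + s)⁻¹ • (h⁺ + s • h⁻) ≤ |h| := by
    have : h⁺ + s • h⁻ ≤ (1 + s) • |h| := by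
      rw [← posPart_add_negPart h, add_smul, one_smul, smul_add]
      refine add_le_add ?_ ?_
      · exact le_add_of_nonneg_right (negPart_nonneg h)
      · exact le_add_of_nonneg_left (smul_nonneg hs (posPart_nonneg h))
    simpa [smul_smul, inv_mul_cancel₀ hc.ne'] using
      smul_le_smul_of_nonneg_left this (inv_nonneg.2 hc.le)
  refine le_antisymm ?_ (le_inf (hnonneg f) (hnonneg g))
  have key : (1 + s)⁻¹ • ((f⁺ + s • f⁻) ⊓ (g⁺ + s • g⁻)) ≤ 0 := by
    rw [← hfg]
    refine le_inf ?_ ?_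
    · exact (smul_le_smul_of_nonneg_left inf_le_left (inv_nonneg.2 hc.le)).trans (hle f)
    · exact (smul_le_smul_of_nonneg_left inf_le_right (inv_nonneg.2 hc.le)).trans (hle g)
  simpa [smul_smul, mul_inv_cancel₀ hc.ne'] using smul_le_smul_of_nonneg_left key hc.le

/-- For disjoint positive elements, the root mean power of the family `f, g, 0, …, 0` is the
sum `f + g`. -/
theorem isLUB_rootMeanPower_of_inf_eq_zero {E : Type*} [Lattice E] [AddCommGroup E]
    [IsOrderedAddMonoid E] [Module ℝ E] [PosSMulMono ℝ E] {r : ℕ} {i j : Fin r} (hij : i ≠ j)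
    {m : ℝ} (hm : m ≠ 0) {f g : E} (hf : 0 ≤ f) (hg : 0 ≤ g) (hfg : f ⊓ g = 0) :
    IsLUB {x : E | ∃ a : Fin r → ℝ, (∀ k, a k ∈ Set.Icc (0 : ℝ) 1) ∧
      (∑ k, (a k) ^ m) = 1 ∧
        x = ∑ k, a k • (Pi.single i f + Pi.single j g : Fin r → E) k} (f + g) := by
  have hmem (l : Fin r) : (Pi.single i f + Pi.single j g : Fin r → E) l ∈
      {x : E | ∃ a : Fin r → ℝ, (∀ k, a k ∈ Set.Icc (0 : ℝ) 1) ∧ (∑ k, (a k) ^ m) = 1 ∧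
        x = ∑ k, a k • (Pi.single i f + Pi.single j g : Fin r → E) k} := by
    refine ⟨Pi.single l 1, fun k => ?_, ?_, ?_⟩
    · by_cases h : k = l
      · subst h; simp
      · simp [h]
    · rw [Finset.sum_eq_single l (fun k _ h => by simp [h, Real.zero_rpow hm]) (by simp)]
      simp
    · rw [Finset.sum_eq_single l (fun k _ h => by simp [h]) (by simp)]
      simp
  refine ⟨?_, fun b hb => ?_⟩
  · rintro x ⟨a, ha, -, rfl⟩
    have hle : ∀ (c : ℝ), c ≤ 1 → ∀ h : E, 0 ≤ h → c • h ≤ h := fun c hc h hh => by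
      have := smul_nonneg (sub_nonneg.2 hc) hh
      rwa [sub_smul, one_smul, sub_nonneg] at this
    have hsum : ∑ k, a k • (Pi.single i f + Pi.single j g : Fin r → E) k =
        a i • f + a j • g := by
      simp only [Pi.add_apply, smul_add, Finset.sum_add_distrib]
      rw [Finset.sum_eq_single i (fun k _ h => by simp [h]) (by simp),
        Finset.sum_eq_single j (fun k _ h => by simp [h]) (by simp)]
      simp
    rw [hsum]
    exact add_le_add (hle _ (ha i).2 f hf) (hle _ (ha j).2 g hg)
  · have hi := hb (hmem i)
    have hj := hb (hmem j)
    simp only [Pi.add_apply, Pi.single_eq_same, Pi.single_eq_of_ne hij,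
      Pi.single_eq_of_ne hij.symm, add_zero, zero_add] at hi hj
    rw [← inf_add_sup, hfg, zero_add]
    exact sup_le hi hj


/-- Theorem 2.2(i). Let `P` be an `n`-homogeneous polynomial (`n ≥ 2`) on an
Archimedean vector lattice `E`. If for all positive `f₁, …, f_r` (`r ≥ 2`) and every `s` which
is the least upper bound of `{∑ a_k • f_k : a_k ∈ [0,1], ∑ a_k ^ m = 1}` (where
`m = n/(n-1)` is the Hölder conjugate of `n`) one has `P s = ∑ P (f_k)`, then `P` is
orthogonally additive. -/
theorem orthAdd_of_rootMeanPower_identity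
    {E V : Type*} [Lattice E] [AddCommGroup E]
    [CovariantClass E E (· + ·) (· ≤ ·)] [Module ℝ E] [PosSMulMono ℝ E]
    [AddCommGroup V] [Module ℝ V]
    (hArch : ∀ x y : E, (∀ n : ℕ, n • x ≤ y) → x ≤ 0)
    (n r : ℕ) (hn : 2 ≤ n) (hr : 2 ≤ r)
    (m : ℝ) (hm : m = (n : ℝ) / ((n : ℝ) - 1))
    (P : E → V)
    (P' : MultilinearMap ℝ (fun _ : Fin n => E) V)
    (hsymm : ∀ (σ : Equiv.Perm (Fin n)) (v : Fin n → E), P' (v ∘ σ) = P' v)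
    (hP : ∀ f : E, P f = P' (fun _ => f))
    (hRMP : ∀ f : Fin r → E, (∀ k, 0 ≤ f k) → ∀ s : E,
      IsLUB {x : E | ∃ a : Fin r → ℝ, (∀ k, a k ∈ Set.Icc (0 : ℝ) 1) ∧
        (∑ k, (a k) ^ m) = 1 ∧ x = ∑ k, a k • f k} s →
      P s = ∑ k, P (f k)) :
    ∀ f g : E, |f| ⊓ |g| = 0 → P (f + g) = P f + P g := by
  have : IsOrderedAddMonoid E :=
    { add_le_add_left := fun a b h c => by
        simpa only [add_comm _ c] using CovariantClass.elim (μ := (· + ·)) (r := (· ≤ ·)) c h }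
  have hm0 : m ≠ 0 := by
    have : (2 : ℝ) ≤ n := by exact_mod_cast hn
    rw [hm]
    exact div_ne_zero (by linarith) (by linarith)
  have hP0 : P 0 = 0 := by
    rw [hP]
    exact P'.map_coord_zero ⟨0, by omega⟩ rfl
  have hpos (f g : E) (hf : 0 ≤ f) (hg : 0 ≤ g) (hfg : f ⊓ g = 0) :
      P (f + g) = P f + P g := by
    have hij : (⟨0, by omega⟩ : Fin r) ≠ ⟨1, by omega⟩ := by simp
    generalize (⟨0, by omega⟩ : Fin r) = i, (⟨1, by omega⟩ : Fin r) = j at hij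
    have hi : (0 : Fin r → E) ≤ Pi.single i f := Pi.single_nonneg.2 hf
    have hj : (0 : Fin r → E) ≤ Pi.single j g := Pi.single_nonneg.2 hg
    rw [hRMP _ (add_nonneg hi hj) _
      (isLUB_rootMeanPower_of_inf_eq_zero hij hm0 hf hg hfg)]
    rw [Fintype.sum_eq_add i j hij fun k hk => by simp [hk.1, hk.2, hP0]]
    simp [hij, hij.symm]
  intro f g hfg
  have hnonneg (h : E) {s : ℝ} (hs : 0 ≤ s) : 0 ≤ h⁺ + s • h⁻ :=
    add_nonneg (posPart_nonneg h) (smul_nonneg hs (negPart_nonneg h))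
  have key := P'.line_additive_of_nonneg f⁺ f⁻ g⁺ g⁻ (fun s hs => by
    simpa only [hP] using hpos _ _ (hnonneg f hs) (hnonneg g hs)
      (posPart_add_smul_negPart_inf_eq_zero hfg hs)) (-1)
  simpa only [neg_smul, one_smul, ← sub_eq_add_neg, posPart_sub_negPart, ← hP] using key
end

section
/- Let n ∈ ℕ with n ≥ 2, let E be an Archimedean vector lattice, let V be a real vector space, and let P : E → V be an n-homogeneous polynomial with symmetric n-linear map Ṗ. Suppose that for all f₁, …, f_n ∈ E⁺ and every g ∈ E such that n • g is the greatest lower bound of the set { ∑_{k=1}^{n} θ_k • f_k : θ₁, …, θ_n ∈ ℝ, each θ_k > 0, θ₁ · θ₂ ⋯ θ_n = 1 }, one has P(g) = Ṗ(f₁, …, f_n). Then P is orthogonally additive. (This is Theorem 2.2(ii): attainment of Kusraeva's geometric-mean identity P(𝔊ₙ(f₁,…,f_n)) = Ṗ(f₁,…,f_n) on the positive cone forces orthogonal additivity, using the explicit infimum formula 𝔊ₙ(f₁,…,f_n) = (1/n) inf{ ∑ θ_k f_k : θ_k > 0, ∏ θ_k = 1 }.) -/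
/-- In an Archimedean vector lattice, the weighted sums defining the geometric mean of positive
elements have infimum `0` as soon as two of the elements are disjoint. -/
theorem isGLB_weightedSums_zero_of_inf_eq_zero
    {E ι : Type*} [Fintype ι] [Lattice E] [AddCommGroup E] [IsOrderedAddMonoid E]
    [Module ℝ E] [PosSMulMono ℝ E]
    (hArch : ∀ x y : E, (∀ n : ℕ, n • x ≤ y) → x ≤ 0)
    (f : ι → E) (hf : ∀ k, 0 ≤ f k) (i j : ι) (hij : f i ⊓ f j = 0) :
    IsGLB {x : E | ∃ θ : ι → ℝ, (∀ k, 0 < θ k) ∧ (∏ k, θ k) = 1 ∧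
      x = ∑ k, θ k • f k} 0 := by
  classical
  constructor
  · rintro x ⟨θ, hθ, -, rfl⟩
    exact Finset.sum_nonneg fun k _ => smul_nonneg (hθ k).le (hf k)
  intro l hl
  apply hArch l (∑ k, f k)
  intro m
  rcases Nat.eq_zero_or_pos m with rfl | hm
  · simpa using Finset.sum_nonneg fun k _ => hf k
  have hm' : (0 : ℝ) < m := by exact_mod_cast hm
  have hε : (0 : ℝ) < (m : ℝ)⁻¹ := inv_pos.2 hm'
  set ε : ℝ := (m : ℝ)⁻¹ with hε_def
  set s : ℝ := (ε ^ (Fintype.card ι - 1))⁻¹ with hs_def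
  have hs : 0 < s := by positivity
  have bound (a : ι) : s⁻¹ • (l - ε • ∑ k, f k) ≤ f a := by
    have hmem : l ≤ ∑ k, Function.update (fun _ => ε) a s k • f k := by
      refine hl ⟨Function.update (fun _ => ε) a s, fun k => ?_, ?_, rfl⟩
      · by_cases hk : k = a
        · subst hk; simpa using hs
        · simpa [hk] using hε
      · rw [Finset.prod_update_of_mem (Finset.mem_univ a), Finset.prod_const,
          Finset.card_sdiff_of_subset (Finset.subset_univ _), Finset.card_univ,
          Finset.card_singleton, hs_def]
        exact inv_mul_cancel₀ (by positivity)
    have hle : ∑ k, Function.update (fun _ => ε) a s k • f k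
        ≤ s • f a + ε • ∑ k, f k := by
      rw [Finset.smul_sum, ← Finset.add_sum_erase _ _ (Finset.mem_univ a),
        Function.update_self]
      gcongr
      rw [← Finset.add_sum_erase _ (fun k => ε • f k) (Finset.mem_univ a)]
      refine le_add_of_nonneg_of_le (smul_nonneg hε.le (hf a)) (le_of_eq ?_)
      refine Finset.sum_congr rfl fun k hk => ?_
      rw [Function.update_of_ne (Finset.ne_of_mem_erase hk)]
    have hsub : l - ε • ∑ k, f k ≤ s • f a := sub_le_iff_le_add.2 (hmem.trans hle)
    have := smul_le_smul_of_nonneg_left hsub (inv_pos.2 hs).le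
    rwa [smul_smul, inv_mul_cancel₀ hs.ne', one_smul] at this
  have hnonpos : s⁻¹ • (l - ε • ∑ k, f k) ≤ 0 := hij ▸ le_inf (bound i) (bound j)
  have hl_le : l - ε • ∑ k, f k ≤ 0 := by
    have := smul_le_smul_of_nonneg_left hnonpos hs.le
    rwa [smul_smul, mul_inv_cancel₀ hs.ne', one_smul, smul_zero] at this
  have := smul_le_smul_of_nonneg_left (sub_nonpos.1 hl_le) hm'.le
  rwa [smul_smul, hε_def, mul_inv_cancel₀ hm'.ne', one_smul, Nat.cast_smul_eq_nsmul] at this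

/-- A multilinear map that vanishes on positive tuples having `i`-th and `j`-th entries disjoint
vanishes on all tuples having `i`-th and `j`-th entries disjoint. -/
theorem MultilinearMap.eq_zero_of_abs_inf_abs_eq_zero
    {E V ι : Type*} [Fintype ι] [Lattice E] [AddCommGroup E] [IsOrderedAddMonoid E]
    [Module ℝ E] [AddCommGroup V] [Module ℝ V]
    (A : MultilinearMap ℝ (fun _ : ι => E) V) (i j : ι)
    (hA : ∀ w : ι → E, (∀ k, 0 ≤ w k) → w i ⊓ w j = 0 → A w = 0)
    (v : ι → E) (hv : |v i| ⊓ |v j| = 0) : A v = 0 := by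
  classical
  have hsplit : v = (fun k => (v k)⁺) + fun k => -(v k)⁻ := by
    ext k
    simp [← sub_eq_add_neg, posPart_sub_negPart]
  rw [hsplit, A.map_add_univ]
  refine Finset.sum_eq_zero fun s _ => ?_
  let w : ι → E := fun k => if k ∈ s then (v k)⁺ else (v k)⁻
  have hw (k : ι) : 0 ≤ w k := by
    dsimp only [w]
    split_ifs
    exacts [posPart_nonneg _, negPart_nonneg _]
  have hw_le (k : ι) : w k ≤ |v k| := by
    rw [← posPart_add_negPart]
    dsimp only [w]
    split_ifs
    exacts [le_add_of_nonneg_right (negPart_nonneg _), le_add_of_nonneg_left (posPart_nonneg _)]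
  have hpiece : s.piecewise (fun k => (v k)⁺) (fun k => -(v k)⁻)
      = fun k => (if k ∈ s then (1 : ℝ) else -1) • w k := by
    ext k
    by_cases hk : k ∈ s <;> simp [w, hk]
  rw [hpiece, A.map_smul_univ, hA w hw, smul_zero]
  exact le_antisymm (hv ▸ inf_le_inf (hw_le i) (hw_le j)) (le_inf (hw i) (hw j))

/-- Theorem 2.2(ii). Let `P` be an `n`-homogeneous polynomial (`n ≥ 2`, with
symmetric `n`-linear map `P'`) on an Archimedean vector lattice `E`. If for all positive
`f₁, …, f_n` and every `g` such that `n • g` is the greatest lower bound of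
`{∑ θ_k • f_k : θ_k > 0, ∏ θ_k = 1}` one has `P g = P' (f₁, …, f_n)` (i.e. Kusraeva's
geometric-mean identity `P (𝔊ₙ(f₁,…,f_n)) = P' (f₁,…,f_n)` holds), then `P` is orthogonally
additive. -/
theorem orthAdd_of_geometricMean_identity
    {E V : Type*} [Lattice E] [AddCommGroup E]
    [CovariantClass E E (· + ·) (· ≤ ·)] [Module ℝ E] [PosSMulMono ℝ E]
    [AddCommGroup V] [Module ℝ V]
    (hArch : ∀ x y : E, (∀ n : ℕ, n • x ≤ y) → x ≤ 0)
    (n : ℕ) (hn : 2 ≤ n)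
    (P : E → V)
    (P' : MultilinearMap ℝ (fun _ : Fin n => E) V)
    (hsymm : ∀ (σ : Equiv.Perm (Fin n)) (v : Fin n → E), P' (v ∘ σ) = P' v)
    (hP : ∀ f : E, P f = P' (fun _ => f))
    (hGM : ∀ f : Fin n → E, (∀ k, 0 ≤ f k) → ∀ g : E,
      IsGLB {x : E | ∃ θ : Fin n → ℝ, (∀ k, 0 < θ k) ∧ (∏ k, θ k) = 1 ∧
        x = ∑ k, θ k • f k} (n • g) →
      P g = P' f) :
    ∀ f g : E, |f| ⊓ |g| = 0 → P (f + g) = P f + P g := by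
  have : IsOrderedAddMonoid E :=
    { add_le_add_left := fun a b h c => by
        simpa only [add_comm] using CovariantClass.elim (μ := (· + ·)) c h }
  have : Nonempty (Fin n) := ⟨⟨0, by lia⟩⟩
  have hP0 : P 0 = 0 := by
    rw [hP]
    exact P'.map_zero
  have hzero (v : Fin n → E) (i j : Fin n) (hv : |v i| ⊓ |v j| = 0) : P' v = 0 := by
    refine P'.eq_zero_of_abs_inf_abs_eq_zero i j (fun w hw hij => ?_) v hv
    rw [← hGM w hw 0, hP0]
    rw [smul_zero]
    exact isGLB_weightedSums_zero_of_inf_eq_zero hArch w hw i j hij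
  intro f g hfg
  have hexpand := P'.map_add_univ (fun _ => f) (fun _ => g)
  have hmixed (s : Finset (Fin n)) (hs : s ≠ Finset.univ ∧ s ≠ ∅) :
      P' (s.piecewise (fun _ => f) (fun _ => g)) = 0 := by
    obtain ⟨i, hi⟩ := Finset.nonempty_iff_ne_empty.2 hs.2
    obtain ⟨j, hj⟩ : ∃ j, j ∉ s := by
      by_contra! h
      exact hs.1 (Finset.eq_univ_iff_forall.2 h)
    exact hzero _ i j (by simpa [hi, hj] using hfg)
  rw [Fintype.sum_eq_add Finset.univ ∅ Finset.univ_nonempty.ne_empty hmixed,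
    Finset.piecewise_univ, Finset.piecewise_empty] at hexpand
  rw [hP, hP, hP]
  exact hexpand
end
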